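/- arXiv:2307.14688 — 4 statements merged into one kernel-verified Lean document; each statement's English description precedes it below -/
import Mathlib

section
/- Let A be an n×n real symmetric positive definite matrix, B an m×n real matrix, and M an m×m real symmetric positive definite matrix. Let α, β > 0 and suppose: (lower bound hypothesis) for every q ∈ ℝ^m there exists v ∈ ℝ^n with ⟨Av, v⟩ > 0 such that ⟨Bv, q⟩² ≥ α ⟨Av, v⟩ ⟨Mq, q⟩; and (upper bound hypothesis) for every q ∈ ℝ^m and every v ∈ ℝ^n, ⟨Bv, q⟩² ≤ β ⟨Av, v⟩ ⟨Mq, q⟩. Then every generalized eigenvalue λ ∈ ℝ of the Schur complement S = B A⁻¹ Bᵀ with respect to M (i.e., S x = λ M x for some x ≠ 0) satisfies α ≤ λ ≤ β. -/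
open Matrix

/-- Cauchy–Schwarz for the bilinear form of a real positive semidefinite matrix. -/
theorem Matrix.PosSemidef.sq_mulVec_dotProduct_le {ι : Type*} [Fintype ι]
    {A : Matrix ι ι ℝ} (hA : A.PosSemidef) (v w : ι → ℝ) :
    (A *ᵥ w ⬝ᵥ v) ^ 2 ≤ (A *ᵥ v ⬝ᵥ v) * (A *ᵥ w ⬝ᵥ w) := by
  have hsymm : A *ᵥ v ⬝ᵥ w = A *ᵥ w ⬝ᵥ v := by
    have hT : Aᵀ = A := hA.isHermitian
    rw [dotProduct_comm, dotProduct_mulVec, ← mulVec_transpose, hT]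
  have hquad (t : ℝ) : 0 ≤ (A *ᵥ v ⬝ᵥ v) * (t * t) + 2 * (A *ᵥ w ⬝ᵥ v) * t
      + A *ᵥ w ⬝ᵥ w := by
    have h := hA.dotProduct_mulVec_nonneg (t • v + w)
    simp only [star_trivial, mulVec_add, mulVec_smul, add_dotProduct, dotProduct_add,
      smul_dotProduct, dotProduct_smul, smul_eq_mul] at h
    rw [dotProduct_comm v, dotProduct_comm v, dotProduct_comm w, dotProduct_comm w, hsymm] at h
    linarith
  have h := discrim_le_zero hquad
  rw [discrim] at h
  linarith

/-- Generalized eigenvalue bounds for the Schur complement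
`S = B * A⁻¹ * Bᵀ` with respect to `M`, given a Rayleigh-quotient lower-bound
(inf-sup) hypothesis and an upper-bound hypothesis. -/
theorem schur_generalized_eigenvalue_bounds {n m : ℕ}
    (A : Matrix (Fin n) (Fin n) ℝ) (hA : A.PosDef)
    (B : Matrix (Fin m) (Fin n) ℝ)
    (M : Matrix (Fin m) (Fin m) ℝ) (hM : M.PosDef)
    (α β : ℝ) (hα : 0 < α) (hβ : 0 < β)
    (hlow : ∀ q : Fin m → ℝ, ∃ v : Fin n → ℝ, 0 < A.mulVec v ⬝ᵥ v ∧
      α * ((A.mulVec v ⬝ᵥ v) * (M.mulVec q ⬝ᵥ q)) ≤ (B.mulVec v ⬝ᵥ q) ^ 2)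
    (hup : ∀ (q : Fin m → ℝ) (v : Fin n → ℝ),
      (B.mulVec v ⬝ᵥ q) ^ 2 ≤ β * ((A.mulVec v ⬝ᵥ v) * (M.mulVec q ⬝ᵥ q)))
    (lam : ℝ) (x : Fin m → ℝ) (hx : x ≠ 0)
    (hev : (B * A⁻¹ * Bᵀ).mulVec x = lam • M.mulVec x) :
    α ≤ lam ∧ lam ≤ β := by
  have hμ : 0 < M *ᵥ x ⬝ᵥ x := by
    have h := hM.dotProduct_mulVec_pos hx
    rwa [star_trivial, dotProduct_comm] at h
  obtain ⟨w, hAw, hBw⟩ : ∃ w, A *ᵥ w = Bᵀ *ᵥ x ∧ B *ᵥ w = lam • M *ᵥ x := by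
    refine ⟨A⁻¹ *ᵥ Bᵀ *ᵥ x, ?_, ?_⟩
    · rw [mulVec_mulVec, mul_nonsing_inv _ ((isUnit_iff_isUnit_det A).1 hA.isUnit), one_mulVec]
    · rw [← hev, mulVec_mulVec, mulVec_mulVec, Matrix.mul_assoc]
  have hB (v : Fin n → ℝ) : B *ᵥ v ⬝ᵥ x = A *ᵥ w ⬝ᵥ v := by
    rw [hAw, dotProduct_comm, dotProduct_mulVec, mulVec_transpose]
  have hw : A *ᵥ w ⬝ᵥ w = lam * (M *ᵥ x ⬝ᵥ x) := by
    rw [← hB, hBw, smul_dotProduct, smul_eq_mul]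
  constructor
  · obtain ⟨v, hv, hle⟩ := hlow x
    rw [hB] at hle
    have h := hle.trans (hA.posSemidef.sq_mulVec_dotProduct_le v w)
    rw [hw] at h
    refine le_of_mul_le_mul_right ?_ (mul_pos hv hμ)
    linarith
  · by_contra! hlt
    have h := hup x w
    rw [hB, hw] at h
    have hlam : 0 < lam := hβ.trans hlt
    have hpos : 0 < (lam - β) * (lam * (M *ᵥ x ⬝ᵥ x) ^ 2) :=
      mul_pos (sub_pos.2 hlt) (by positivity)
    linarith
end

section
/- Fix parameters ν₀ > 0, ε > 0, p ∈ (1, 2], γ ∈ {0, 1}, a measurable set Ω ⊆ ℝ^d, a differentiable vector field u^k : ℝ^d → ℝ^d, and a constant K ≥ 0 with |Du^k(x)| ≤ K for all x ∈ Ω. Then for every differentiable, compactly supported in Ω vector field v : ℝ^d → ℝ^d of class C² and every square-integrable q : Ω → ℝ, (∫_Ω q (div v) dx)² ≤ [(ε² + K²)^{(2-p)/2} / (ν₀ (1 + γ(p-2)))] · a'(u^k)(v, v) · ∫_Ω q² dx, assuming all integrands appearing are integrable on Ω. -/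
open MeasureTheory Matrix

noncomputable def jac {d : ℕ} (u : (Fin d → ℝ) → (Fin d → ℝ)) (x : Fin d → ℝ) :
    Matrix (Fin d) (Fin d) ℝ :=
  fun i j => fderiv ℝ u x (Pi.single j 1) i

noncomputable def strain {d : ℕ} (u : (Fin d → ℝ) → (Fin d → ℝ)) (x : Fin d → ℝ) :
    Matrix (Fin d) (Fin d) ℝ :=
  fun i j => (jac u x i j + jac u x j i) / 2

noncomputable def divg {d : ℕ} (u : (Fin d → ℝ) → (Fin d → ℝ)) (x : Fin d → ℝ) : ℝ :=
  ∑ i, jac u x i i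

def frob {d : ℕ} (A B : Matrix (Fin d) (Fin d) ℝ) : ℝ := ∑ i, ∑ j, A i j * B i j

/-- The linearized viscous form a'(u^k)(v, v). -/
noncomputable def aform {d : ℕ} (ν₀ ε p γ : ℝ) (Ω : Set (Fin d → ℝ))
    (uk v : (Fin d → ℝ) → (Fin d → ℝ)) : ℝ :=
  ∫ x in Ω,
    (ν₀ * (ε ^ 2 + frob (strain uk x) (strain uk x)) ^ ((p - 2) / 2) *
        frob (strain v x) (strain v x)
      + γ * (p - 2) * ν₀ *
          (ε ^ 2 + frob (strain uk x) (strain uk x)) ^ ((p - 4) / 2) *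
          (frob (strain uk x) (strain v x)) ^ 2)

lemma jac_apply {d : ℕ} {u : (Fin d → ℝ) → (Fin d → ℝ)} (hu : Differentiable ℝ u)
    (x : Fin d → ℝ) (i j : Fin d) :
    jac u x i j = fderiv ℝ (fun y => u y i) x (Pi.single j 1) := by
  have h := fderiv_pi (𝕜 := ℝ) (φ := fun i y => u y i) (x := x)
    (fun i => (differentiable_pi.1 hu i) x)
  change fderiv ℝ (fun y i => u y i) x (Pi.single j 1) i = _
  rw [h]
  rfl

/-- Two integrations by parts exchange the directions of differentiation in a product of
directional derivatives. -/
lemma integral_fderiv_mul_fderiv_comm {E : Type*} [NormedAddCommGroup E] [NormedSpace ℝ E]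
    [FiniteDimensional ℝ E] [MeasurableSpace E] [BorelSpace E] (μ : Measure E)
    [μ.IsAddHaarMeasure] {f g : E → ℝ} (hf : ContDiff ℝ 1 f) (hfc : HasCompactSupport f)
    (hg : ContDiff ℝ 2 g) (a b : E) :
    ∫ x, fderiv ℝ f x a * fderiv ℝ g x b ∂μ = ∫ x, fderiv ℝ f x b * fderiv ℝ g x a ∂μ := by
  have hf' : ∀ c, Continuous fun x => fderiv ℝ f x c := fun c =>
    (hf.continuous_fderiv one_ne_zero).clm_apply continuous_const
  have hfderivg : ContDiff ℝ 1 (fderiv ℝ g) := hg.fderiv_right (by norm_num)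
  have hg1 : ∀ c, ContDiff ℝ 1 fun x => fderiv ℝ g x c := fun c =>
    hfderivg.clm_apply contDiff_const
  have hg2 : ∀ c e, Continuous fun x => fderiv ℝ (fun y => fderiv ℝ g y c) x e := fun c e =>
    ((hg1 c).continuous_fderiv one_ne_zero).clm_apply continuous_const
  have hparts : ∀ c e, ∫ x, f x * fderiv ℝ (fun y => fderiv ℝ g y e) x c ∂μ
      = - ∫ x, fderiv ℝ f x c * fderiv ℝ g x e ∂μ := by
    intro c e
    apply integral_mul_fderiv_eq_neg_fderiv_mul_of_integrable
    · exact ((hf' c).mul (hg1 e).continuous).integrable_of_hasCompactSupport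
        ((hfc.fderiv_apply ℝ c).mul_right)
    · exact (hf.continuous.mul (hg2 e c)).integrable_of_hasCompactSupport hfc.mul_right
    · exact (hf.continuous.mul (hg1 e).continuous).integrable_of_hasCompactSupport hfc.mul_right
    · exact fun x _ => hf.differentiable one_ne_zero x
    · exact fun x _ => (hg1 e).differentiable one_ne_zero x
  have hsymm : ∀ x, fderiv ℝ (fun y => fderiv ℝ g y b) x a
      = fderiv ℝ (fun y => fderiv ℝ g y a) x b := by
    intro x
    have hd : DifferentiableAt ℝ (fderiv ℝ g) x := hfderivg.differentiable one_ne_zero x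
    have h := hg.contDiffAt.isSymmSndFDerivAt (x := x) (by simp) a b
    rw [fderiv_clm_apply hd (differentiableAt_const b),
      fderiv_clm_apply hd (differentiableAt_const a)]
    simpa using h
  have h1 := hparts a b
  have h2 := hparts b a
  simp_rw [hsymm] at h1
  linarith

lemma frob_self_nonneg {d : ℕ} (A : Matrix (Fin d) (Fin d) ℝ) : 0 ≤ frob A A :=
  Finset.sum_nonneg fun _ _ => Finset.sum_nonneg fun _ _ => mul_self_nonneg _

lemma frob_sq_le {d : ℕ} (A B : Matrix (Fin d) (Fin d) ℝ) :
    frob A B ^ 2 ≤ frob A A * frob B B := by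
  have h := Finset.sum_mul_sq_le_sq_mul_sq (Finset.univ : Finset (Fin d × Fin d))
    (fun ij => A ij.1 ij.2) (fun ij => B ij.1 ij.2)
  simpa only [frob, Fintype.sum_prod_type, pow_two] using h

lemma sum_jac_mul_transpose_le {d : ℕ} (u : (Fin d → ℝ) → (Fin d → ℝ)) (x : Fin d → ℝ) :
    ∑ i, ∑ j, jac u x i j * jac u x j i ≤ frob (strain u x) (strain u x) := by
  refine Finset.sum_le_sum fun i _ => Finset.sum_le_sum fun j _ => ?_
  simp only [strain]
  nlinarith [sq_nonneg (jac u x i j - jac u x j i)]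

lemma jac_eq_zero_of_notMem_tsupport {d : ℕ} {u : (Fin d → ℝ) → (Fin d → ℝ)} {x : Fin d → ℝ}
    (hx : x ∉ tsupport u) : jac u x = 0 := by
  ext i j
  simp [jac, fderiv_of_notMem_tsupport (𝕜 := ℝ) hx]

/-- Korn-type inequality with constant one for compactly supported fields. -/
lemma integral_divg_sq_le {d : ℕ} {Ω : Set (Fin d → ℝ)} {v : (Fin d → ℝ) → (Fin d → ℝ)}
    (hv : ContDiff ℝ 2 v) (hvcpt : HasCompactSupport v) (hvΩ : tsupport v ⊆ Ω) :
    ∫ x in Ω, divg v x ^ 2 ≤ ∫ x in Ω, frob (strain v x) (strain v x) := by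
  have hvd : Differentiable ℝ v := hv.differentiable two_ne_zero
  have hzero : ∀ x, x ∉ Ω → jac v x = 0 := fun x hx =>
    jac_eq_zero_of_notMem_tsupport fun h => hx (hvΩ h)
  have hcomp : ∀ i, ContDiff ℝ 2 fun x => v x i := fun i => contDiff_pi.1 hv i
  have hcompc : ∀ i, HasCompactSupport fun x => v x i := fun i =>
    hvcpt.comp_left (g := fun w : Fin d → ℝ => w i) rfl
  have hcont : ∀ i j, Continuous fun x => jac v x i j := by
    intro i j
    simp_rw [jac_apply hvd]
    exact ((hcomp i).continuous_fderiv two_ne_zero).clm_apply continuous_const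
  have hjc : ∀ i j, HasCompactSupport fun x => jac v x i j := by
    intro i j
    simp_rw [jac_apply hvd]
    exact (hcompc i).fderiv_apply ℝ _
  have hint : ∀ i j k l, Integrable fun x => jac v x i j * jac v x k l := fun i j k l =>
    ((hcont i j).mul (hcont k l)).integrable_of_hasCompactSupport (hjc i j).mul_right
  rw [setIntegral_eq_integral_of_forall_compl_eq_zero (fun x hx => by simp [divg, hzero x hx]),
    setIntegral_eq_integral_of_forall_compl_eq_zero
      (fun x hx => by simp [frob, strain, hzero x hx])]
  have hswap : ∀ i j, ∫ x, jac v x i i * jac v x j j = ∫ x, jac v x i j * jac v x j i := by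
    intro i j
    simp_rw [jac_apply hvd]
    exact integral_fderiv_mul_fderiv_comm volume ((hcomp i).of_le (by norm_num)) (hcompc i)
      (hcomp j) _ _
  calc ∫ x, divg v x ^ 2 = ∫ x, ∑ i, ∑ j, jac v x i i * jac v x j j := by
        simp_rw [divg, pow_two, Finset.sum_mul_sum]
    _ = ∫ x, ∑ i, ∑ j, jac v x i j * jac v x j i := by
        rw [integral_finsetSum _ fun i _ => integrable_finsetSum _ fun j _ => hint i i j j,
          integral_finsetSum _ fun i _ => integrable_finsetSum _ fun j _ => hint i j j i]
        refine Finset.sum_congr rfl fun i _ => ?_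
        rw [integral_finsetSum _ fun j _ => hint i i j j,
          integral_finsetSum _ fun j _ => hint i j j i]
        exact Finset.sum_congr rfl fun j _ => hswap i j
    _ ≤ ∫ x, frob (strain v x) (strain v x) := by
        refine integral_mono
          (integrable_finsetSum _ fun i _ => integrable_finsetSum _ fun j _ => hint i j j i) ?_
          (sum_jac_mul_transpose_le v)
        refine integrable_finsetSum _ fun i _ => integrable_finsetSum _ fun j _ => ?_
        have h := ((((hint i j i j).add (hint i j j i)).add (hint j i i j)).add
          (hint j i j i)).div_const 4
        refine h.congr (.of_forall fun x => ?_)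
        simp only [strain, Pi.add_apply]
        ring

lemma sq_integral_mul_le {α : Type*} [MeasurableSpace α] {μ : Measure α} {f g : α → ℝ}
    (hf : Integrable (fun x => f x ^ 2) μ) (hfg : Integrable (fun x => f x * g x) μ)
    (hg : Integrable (fun x => g x ^ 2) μ) :
    (∫ x, f x * g x ∂μ) ^ 2 ≤ (∫ x, f x ^ 2 ∂μ) * ∫ x, g x ^ 2 ∂μ := by
  have h : discrim (∫ x, f x ^ 2 ∂μ) (2 * ∫ x, f x * g x ∂μ) (∫ x, g x ^ 2 ∂μ) ≤ 0 := by
    refine discrim_le_zero fun t => ?_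
    have heq : ∫ x, (t * f x + g x) ^ 2 ∂μ = (∫ x, f x ^ 2 ∂μ) * (t * t)
        + (2 * ∫ x, f x * g x ∂μ) * t + ∫ x, g x ^ 2 ∂μ := by
      calc ∫ x, (t * f x + g x) ^ 2 ∂μ
          = ∫ x, (t * t * f x ^ 2 + 2 * t * (f x * g x) + g x ^ 2) ∂μ := by
            congr 1; ext x; ring
        _ = _ := by
            have hsum : Integrable (fun x => t * t * f x ^ 2 + 2 * t * (f x * g x)) μ :=
              (hf.const_mul _).add (hfg.const_mul _)
            rw [integral_add hsum hg,
              integral_add (hf.const_mul _) (hfg.const_mul _), integral_const_mul,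
              integral_const_mul]
            ring
    rw [← heq]
    exact integral_nonneg fun x => sq_nonneg _
  rw [discrim] at h
  nlinarith

/-- Pointwise coercivity of the linearized viscous form. -/
lemma viscous_integrand_lower_bound {d : ℕ} {ν₀ ε p γ K : ℝ} (hν₀ : 0 < ν₀) (hε : 0 < ε)
    (hp2 : p ≤ 2) (hγ0 : 0 ≤ γ) (hcoer : 0 ≤ 1 + γ * (p - 2))
    (A B : Matrix (Fin d) (Fin d) ℝ) (hA : frob A A ≤ K ^ 2) :
    ν₀ * (1 + γ * (p - 2)) * (ε ^ 2 + K ^ 2) ^ ((p - 2) / 2) * frob B B ≤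
      ν₀ * (ε ^ 2 + frob A A) ^ ((p - 2) / 2) * frob B B
        + γ * (p - 2) * ν₀ * (ε ^ 2 + frob A A) ^ ((p - 4) / 2) * frob A B ^ 2 := by
  have hA0 := frob_self_nonneg A
  have hB0 := frob_self_nonneg B
  have hs : 0 < ε ^ 2 + frob A A := by positivity
  have hmono : (ε ^ 2 + K ^ 2) ^ ((p - 2) / 2) ≤ (ε ^ 2 + frob A A) ^ ((p - 2) / 2) :=
    Real.rpow_le_rpow_of_nonpos hs (by linarith) (by linarith)
  have hCS : (ε ^ 2 + frob A A) ^ ((p - 4) / 2) * frob A B ^ 2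
      ≤ (ε ^ 2 + frob A A) ^ ((p - 2) / 2) * frob B B := by
    have hpow : (ε ^ 2 + frob A A) ^ ((p - 2) / 2)
        = (ε ^ 2 + frob A A) ^ ((p - 4) / 2) * (ε ^ 2 + frob A A) := by
      rw [← Real.rpow_add_one hs.ne']
      congr 1
      ring
    rw [hpow, mul_assoc]
    refine mul_le_mul_of_nonneg_left ((frob_sq_le A B).trans ?_) (by positivity)
    exact mul_le_mul_of_nonneg_right (by nlinarith) hB0
  have hneg : 0 ≤ ν₀ * (γ * (2 - p)) :=
    mul_nonneg hν₀.le (mul_nonneg hγ0 (by linarith))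
  have h1 := mul_le_mul_of_nonneg_left hCS hneg
  have h2 := mul_le_mul_of_nonneg_left (mul_le_mul_of_nonneg_right hmono hB0)
    (mul_nonneg hν₀.le hcoer)
  linarith

/-- Upper bound of Proposition 4.3(i): the Schur complement
quadratic form is bounded by a multiple of the pressure mass matrix form. -/
theorem schur_upper_bound_mass_matrix {d : ℕ} (ν₀ ε p γ : ℝ)
    (hν₀ : 0 < ν₀) (hε : 0 < ε) (hp1 : 1 < p) (hp2 : p ≤ 2)
    (hγ : γ = 0 ∨ γ = 1)
    (Ω : Set (Fin d → ℝ)) (hΩ : MeasurableSet Ω)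
    (uk : (Fin d → ℝ) → (Fin d → ℝ)) (huk : Differentiable ℝ uk)
    (K : ℝ) (hK : 0 ≤ K)
    (hbound : ∀ x ∈ Ω, Real.sqrt (frob (strain uk x) (strain uk x)) ≤ K)
    (v : (Fin d → ℝ) → (Fin d → ℝ)) (hv : ContDiff ℝ 2 v)
    (hvcpt : HasCompactSupport v) (hvΩ : tsupport v ⊆ Ω)
    (q : (Fin d → ℝ) → ℝ)
    (hq2 : IntegrableOn (fun x => (q x) ^ 2) Ω)
    (hqdiv : IntegrableOn (fun x => q x * divg v x) Ω)
    (hdiv2 : IntegrableOn (fun x => (divg v x) ^ 2) Ω)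
    (hDv2 : IntegrableOn (fun x => frob (strain v x) (strain v x)) Ω)
    (haint : IntegrableOn (fun x =>
      ν₀ * (ε ^ 2 + frob (strain uk x) (strain uk x)) ^ ((p - 2) / 2) *
          frob (strain v x) (strain v x)
        + γ * (p - 2) * ν₀ *
            (ε ^ 2 + frob (strain uk x) (strain uk x)) ^ ((p - 4) / 2) *
            (frob (strain uk x) (strain v x)) ^ 2) Ω) :
    (∫ x in Ω, q x * divg v x) ^ 2 ≤
      ((ε ^ 2 + K ^ 2) ^ ((2 - p) / 2) / (ν₀ * (1 + γ * (p - 2)))) *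
        aform ν₀ ε p γ Ω uk v * ∫ x in Ω, (q x) ^ 2 := by
  have hγ0 : 0 ≤ γ := by rcases hγ with rfl | rfl <;> norm_num
  have hcoer : 0 < 1 + γ * (p - 2) := by rcases hγ with rfl | rfl <;> linarith
  have hS : 0 < ε ^ 2 + K ^ 2 := by positivity
  have hform : ν₀ * (1 + γ * (p - 2)) * (ε ^ 2 + K ^ 2) ^ ((p - 2) / 2) *
      ∫ x in Ω, frob (strain v x) (strain v x) ≤ aform ν₀ ε p γ Ω uk v := by
    rw [← integral_const_mul]
    refine setIntegral_mono_on (hDv2.const_mul _) haint hΩ fun x hx => ?_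
    refine viscous_integrand_lower_bound hν₀ hε hp2 hγ0 hcoer.le _ _ ?_
    exact (Real.sqrt_le_left hK).1 (hbound x hx)
  have hdiv : ∫ x in Ω, divg v x ^ 2 ≤
      ((ε ^ 2 + K ^ 2) ^ ((2 - p) / 2) / (ν₀ * (1 + γ * (p - 2)))) * aform ν₀ ε p γ Ω uk v := by
    refine (integral_divg_sq_le hv hvcpt hvΩ).trans ?_
    have hinv : (ε ^ 2 + K ^ 2) ^ ((2 - p) / 2) * (ε ^ 2 + K ^ 2) ^ ((p - 2) / 2) = 1 := by
      rw [← Real.rpow_add hS, show (2 - p) / 2 + (p - 2) / 2 = 0 by ring, Real.rpow_zero]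
    rw [div_mul_eq_mul_div, le_div_iff₀ (by positivity)]
    calc (∫ x in Ω, frob (strain v x) (strain v x)) * (ν₀ * (1 + γ * (p - 2)))
        = (ε ^ 2 + K ^ 2) ^ ((2 - p) / 2) * (ν₀ * (1 + γ * (p - 2)) *
            (ε ^ 2 + K ^ 2) ^ ((p - 2) / 2) * ∫ x in Ω, frob (strain v x) (strain v x)) := by
          linear_combination (-(∫ x in Ω, frob (strain v x) (strain v x)) *
            (ν₀ * (1 + γ * (p - 2)))) * hinv
      _ ≤ _ := mul_le_mul_of_nonneg_left hform (by positivity)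
  refine (sq_integral_mul_le hq2 hqdiv hdiv2).trans ?_
  rw [mul_comm]
  exact mul_le_mul_of_nonneg_right hdiv (integral_nonneg fun x => sq_nonneg _)
end

section
/- Fix parameters ν₀ > 0, ε > 0, p ∈ (1, 2], γ ∈ {0, 1}, a measurable set Ω ⊆ ℝ^d, and a differentiable vector field u^k : ℝ^d → ℝ^d, and set ν_k(x) = ν₀ (ε² + |Du^k(x)|²)^{(p-2)/2}. Then for every differentiable vector field v : ℝ^d → ℝ^d and every measurable q : Ω → ℝ, (∫_Ω q (div v) dx)² ≤ (d / (1 + γ(p-2))) · a'(u^k)(v, v) · ∫_Ω ν_k⁻¹ q² dx, assuming all integrands appearing are integrable on Ω. -/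
open MeasureTheory Matrix

/-- Cauchy-Schwarz for integrals, from a pointwise bound `h ^ 2 ≤ f * g`. -/
lemma sq_integral_le_mul_integral {α : Type*} [MeasurableSpace α] {μ : Measure α} {f g h : α → ℝ}
    (hf : Integrable f μ) (hg : Integrable g μ) (hh : Integrable h μ)
    (hf0 : ∀ x, 0 ≤ f x) (hg0 : ∀ x, 0 ≤ g x) (hfg : ∀ x, h x ^ 2 ≤ f x * g x) :
    (∫ x, h x ∂μ) ^ 2 ≤ (∫ x, f x ∂μ) * ∫ x, g x ∂μ := by
  have key : ∀ t : ℝ, 0 ≤ (∫ x, f x ∂μ) * (t * t) + (2 * ∫ x, h x ∂μ) * t + ∫ x, g x ∂μ := by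
    intro t
    have hpos : 0 ≤ ∫ x, f x * (t * t) + h x * (2 * t) + g x ∂μ := by
      refine integral_nonneg fun x => ?_
      have hsq : (h x * (2 * t)) ^ 2 ≤ (f x * (t * t) + g x) ^ 2 := by
        nlinarith [mul_le_mul_of_nonneg_right (hfg x) (sq_nonneg t),
          sq_nonneg (f x * (t * t) - g x)]
      have h0 : 0 ≤ f x * (t * t) + g x :=
        add_nonneg (mul_nonneg (hf0 x) (mul_self_nonneg t)) (hg0 x)
      have := (abs_le_of_sq_le_sq' hsq h0).1
      simp only [Pi.zero_apply]
      linarith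
    have hfh : Integrable (fun x => f x * (t * t) + h x * (2 * t)) μ :=
      (hf.mul_const _).add (hh.mul_const _)
    rw [integral_add hfh hg,
      integral_add (hf.mul_const _) (hh.mul_const _), integral_mul_const,
      integral_mul_const] at hpos
    linarith
  have := discrim_le_zero key
  unfold discrim at this
  linarith

lemma trace_sq_le_frob {d : ℕ} (A : Matrix (Fin d) (Fin d) ℝ) :
    A.trace ^ 2 ≤ d * frob A A := by
  have h1 : frob A 1 = A.trace := by simp [frob, Matrix.one_apply, Matrix.trace]
  have h2 : frob (1 : Matrix (Fin d) (Fin d) ℝ) 1 = d := by simp [frob, Matrix.one_apply]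
  simpa [h1, h2, mul_comm] using frob_sq_le A 1

lemma trace_strain {d : ℕ} (u : (Fin d → ℝ) → (Fin d → ℝ)) (x : Fin d → ℝ) :
    (strain u x).trace = divg u x := by
  simp [Matrix.trace, strain, divg]

/-- Coercivity of the linearized viscous stress, with `A` the strain at the linearization point. -/
lemma linearized_stress_coercive {d : ℕ} {ν₀ ε p γ : ℝ} (hν₀ : 0 < ν₀) (hε : 0 < ε)
    (hγp : γ * (p - 2) ≤ 0) (A B : Matrix (Fin d) (Fin d) ℝ) :
    (1 + γ * (p - 2)) * (ν₀ * (ε ^ 2 + frob A A) ^ ((p - 2) / 2) * frob B B) ≤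
      ν₀ * (ε ^ 2 + frob A A) ^ ((p - 2) / 2) * frob B B
        + γ * (p - 2) * ν₀ * (ε ^ 2 + frob A A) ^ ((p - 4) / 2) * frob A B ^ 2 := by
  have hA := frob_self_nonneg A
  have hS : 0 < ε ^ 2 + frob A A := by positivity
  have hrpow : (ε ^ 2 + frob A A) ^ ((p - 2) / 2)
      = (ε ^ 2 + frob A A) ^ ((p - 4) / 2) * (ε ^ 2 + frob A A) := by
    rw [← Real.rpow_add_one hS.ne']
    ring_nf
  have hAB : frob A B ^ 2 ≤ (ε ^ 2 + frob A A) * frob B B :=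
    (frob_sq_le A B).trans
      (mul_le_mul_of_nonneg_right (by linarith [sq_nonneg ε]) (frob_self_nonneg B))
  have hle := mul_le_mul_of_nonneg_left hAB
    (mul_pos hν₀ (Real.rpow_pos_of_pos hS ((p - 4) / 2))).le
  have := mul_le_mul_of_nonpos_left hle hγp
  rw [hrpow]
  linarith

/-- Upper bound of Proposition 4.3(ii): the Schur complement
quadratic form is bounded above by `d/(1+γ(p-2))` times the viscosity-scaled
pressure mass matrix quadratic form. -/
theorem schur_upper_bound_viscosity_scaled {d : ℕ} (ν₀ ε p γ : ℝ)
    (hν₀ : 0 < ν₀) (hε : 0 < ε) (hp1 : 1 < p) (hp2 : p ≤ 2)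
    (hγ : γ = 0 ∨ γ = 1)
    (Ω : Set (Fin d → ℝ)) (hΩ : MeasurableSet Ω)
    (uk : (Fin d → ℝ) → (Fin d → ℝ)) (huk : Differentiable ℝ uk)
    (v : (Fin d → ℝ) → (Fin d → ℝ)) (hv : Differentiable ℝ v)
    (q : (Fin d → ℝ) → ℝ) (hq : Measurable q)
    (hqdiv : IntegrableOn (fun x => q x * divg v x) Ω)
    (hnuq2 : IntegrableOn (fun x =>
      (ν₀ * (ε ^ 2 + frob (strain uk x) (strain uk x)) ^ ((p - 2) / 2))⁻¹ * (q x) ^ 2) Ω)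
    (hnudiv2 : IntegrableOn (fun x =>
      (ν₀ * (ε ^ 2 + frob (strain uk x) (strain uk x)) ^ ((p - 2) / 2)) * (divg v x) ^ 2) Ω)
    (hnuDv2 : IntegrableOn (fun x =>
      (ν₀ * (ε ^ 2 + frob (strain uk x) (strain uk x)) ^ ((p - 2) / 2)) * frob (strain v x) (strain v x)) Ω)
    (haint : IntegrableOn (fun x =>
      ν₀ * (ε ^ 2 + frob (strain uk x) (strain uk x)) ^ ((p - 2) / 2) *
          frob (strain v x) (strain v x)
        + γ * (p - 2) * ν₀ *
            (ε ^ 2 + frob (strain uk x) (strain uk x)) ^ ((p - 4) / 2) *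
            (frob (strain uk x) (strain v x)) ^ 2) Ω) :
    (∫ x in Ω, q x * divg v x) ^ 2 ≤
      ((d : ℝ) / (1 + γ * (p - 2))) * aform ν₀ ε p γ Ω uk v *
        ∫ x in Ω, (ν₀ * (ε ^ 2 + frob (strain uk x) (strain uk x)) ^ ((p - 2) / 2))⁻¹ *
          (q x) ^ 2 := by
  have hγp : γ * (p - 2) ≤ 0 := by rcases hγ with rfl | rfl <;> linarith
  have hc : 0 < 1 + γ * (p - 2) := by rcases hγ with rfl | rfl <;> linarith
  have hν : ∀ x, 0 < ν₀ * (ε ^ 2 + frob (strain uk x) (strain uk x)) ^ ((p - 2) / 2) := fun x =>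
    mul_pos hν₀ (Real.rpow_pos_of_pos
      (add_pos_of_pos_of_nonneg (pow_pos hε 2) (frob_self_nonneg _)) _)
  have hdiv : ∀ x, ν₀ * (ε ^ 2 + frob (strain uk x) (strain uk x)) ^ ((p - 2) / 2)
      * divg v x ^ 2 ≤ (d : ℝ) / (1 + γ * (p - 2)) *
        (ν₀ * (ε ^ 2 + frob (strain uk x) (strain uk x)) ^ ((p - 2) / 2) *
            frob (strain v x) (strain v x)
          + γ * (p - 2) * ν₀ *
              (ε ^ 2 + frob (strain uk x) (strain uk x)) ^ ((p - 4) / 2) *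
              (frob (strain uk x) (strain v x)) ^ 2) := by
    intro x
    have htr := mul_le_mul_of_nonneg_left (trace_sq_le_frob (strain v x)) (hν x).le
    rw [trace_strain] at htr
    have hco := mul_le_mul_of_nonneg_left
      (linearized_stress_coercive hν₀ hε hγp (strain uk x) (strain v x)) d.cast_nonneg
    rw [div_mul_eq_mul_div, le_div_iff₀ hc]
    have := mul_le_mul_of_nonneg_right htr hc.le
    linarith
  unfold aform
  rw [← integral_const_mul ((d : ℝ) / (1 + γ * (p - 2)))]
  refine sq_integral_le_mul_integral (haint.const_mul _) hnuq2 hqdiv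
    (fun x => (mul_nonneg (hν x).le (sq_nonneg _)).trans (hdiv x))
    (fun x => mul_nonneg (inv_nonneg.2 (hν x).le) (sq_nonneg _)) fun x => ?_
  have hq0 := mul_nonneg (inv_nonneg.2 (hν x).le) (sq_nonneg (q x))
  refine le_trans (le_of_eq ?_) (mul_le_mul_of_nonneg_right (hdiv x) hq0)
  rw [mul_mul_mul_comm, mul_inv_cancel₀ (hν x).ne', one_mul, ← mul_pow, mul_comm (q x)]
end

section
/- Fix parameters ν₀ > 0, ε > 0, p ∈ (1, 2], γ ∈ {0, 1}, a measurable set Ω ⊆ ℝ^d, a differentiable vector field u^k : ℝ^d → ℝ^d, and a constant K ≥ 0 with |Du^k(x)| ≤ K for all x ∈ Ω. Then for every differentiable vector field v : ℝ^d → ℝ^d, a'(u^k)(v, v) ≥ (1 + γ(p-2)) ν₀ (ε² + K²)^{(p-2)/2} ∫_Ω |Dv|² dx, assuming all integrands appearing are integrable on Ω. -/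
open MeasureTheory Matrix

/-- Pointwise coercivity of the linearized power-law viscosity, where `a`, `b`, `q` stand for
`|A|²`, `|B|²`, `A : B` and `c` for `γ (p - 2)`. -/
lemma viscous_density_ge {ν₀ ε p c a b q K : ℝ} (hν₀ : 0 ≤ ν₀) (hε : 0 < ε) (hp : p ≤ 2)
    (hc : c ≤ 0) (hc' : 0 ≤ 1 + c) (ha : 0 ≤ a) (haK : a ≤ K ^ 2) (hb : 0 ≤ b)
    (hq : q ^ 2 ≤ a * b) :
    (1 + c) * ν₀ * (ε ^ 2 + K ^ 2) ^ ((p - 2) / 2) * b ≤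
      ν₀ * (ε ^ 2 + a) ^ ((p - 2) / 2) * b + c * ν₀ * (ε ^ 2 + a) ^ ((p - 4) / 2) * q ^ 2 := by
  have hs : 0 < ε ^ 2 + a := by positivity
  have hmono : (ε ^ 2 + K ^ 2) ^ ((p - 2) / 2) ≤ (ε ^ 2 + a) ^ ((p - 2) / 2) :=
    Real.rpow_le_rpow_of_nonpos hs (by linarith) (by linarith)
  have hexp : (ε ^ 2 + a) ^ ((p - 2) / 2) = (ε ^ 2 + a) ^ ((p - 4) / 2) * (ε ^ 2 + a) := by
    rw [← Real.rpow_add_one hs.ne']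
    congr 1
    ring
  have hqs : (ε ^ 2 + a) ^ ((p - 4) / 2) * q ^ 2 ≤ (ε ^ 2 + a) ^ ((p - 2) / 2) * b := by
    rw [hexp, mul_assoc]
    gcongr
    nlinarith [mul_nonneg (sq_nonneg ε) hb]
  calc (1 + c) * ν₀ * (ε ^ 2 + K ^ 2) ^ ((p - 2) / 2) * b
      ≤ (1 + c) * ν₀ * (ε ^ 2 + a) ^ ((p - 2) / 2) * b := by gcongr
    _ = ν₀ * (ε ^ 2 + a) ^ ((p - 2) / 2) * b
          + c * ν₀ * ((ε ^ 2 + a) ^ ((p - 2) / 2) * b) := by ring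
    _ ≤ ν₀ * (ε ^ 2 + a) ^ ((p - 2) / 2) * b
          + c * ν₀ * ((ε ^ 2 + a) ^ ((p - 4) / 2) * q ^ 2) := by
        have := mul_le_mul_of_nonpos_left hqs (mul_nonpos_of_nonpos_of_nonneg hc hν₀)
        gcongr
    _ = _ := by ring

/-- Second inequality of Lemma 4.3(i), with `K` playing the role
of `‖Du^k‖_{L^∞(Ω)}`:
`a'(u^k)(v, v) ≥ (1 + γ(p-2)) ν₀ (ε² + K²)^{(p-2)/2} ‖Dv‖²`. -/
theorem aform_ge_strain_with_Linfty_bound {d : ℕ} (ν₀ ε p γ : ℝ)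
    (hν₀ : 0 < ν₀) (hε : 0 < ε) (hp1 : 1 < p) (hp2 : p ≤ 2)
    (hγ : γ = 0 ∨ γ = 1)
    (Ω : Set (Fin d → ℝ)) (hΩ : MeasurableSet Ω)
    (uk : (Fin d → ℝ) → (Fin d → ℝ)) (huk : Differentiable ℝ uk)
    (K : ℝ) (hK : 0 ≤ K)
    (hbound : ∀ x ∈ Ω, Real.sqrt (frob (strain uk x) (strain uk x)) ≤ K)
    (v : (Fin d → ℝ) → (Fin d → ℝ)) (hv : Differentiable ℝ v)
    (haint : IntegrableOn (fun x =>
      ν₀ * (ε ^ 2 + frob (strain uk x) (strain uk x)) ^ ((p - 2) / 2) *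
          frob (strain v x) (strain v x)
        + γ * (p - 2) * ν₀ *
            (ε ^ 2 + frob (strain uk x) (strain uk x)) ^ ((p - 4) / 2) *
            (frob (strain uk x) (strain v x)) ^ 2) Ω)
    (hDv2 : IntegrableOn (fun x => frob (strain v x) (strain v x)) Ω) :
    aform ν₀ ε p γ Ω uk v ≥
      (1 + γ * (p - 2)) * ν₀ * (ε ^ 2 + K ^ 2) ^ ((p - 2) / 2) *
        ∫ x in Ω, frob (strain v x) (strain v x) := by
  rw [ge_iff_le, aform, ← integral_const_mul]
  refine setIntegral_mono_on (hDv2.const_mul _) haint hΩ fun x hx => ?_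
  have hc : γ * (p - 2) ≤ 0 := by rcases hγ with rfl | rfl <;> linarith
  have hc' : 0 ≤ 1 + γ * (p - 2) := by rcases hγ with rfl | rfl <;> linarith
  exact viscous_density_ge hν₀.le hε hp2 hc hc' (frob_self_nonneg _)
    ((Real.sqrt_le_left hK).mp (hbound x hx)) (frob_self_nonneg _) (frob_sq_le _ _)
end
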